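/- Fix k ∈ N and let P, Q ⊂ R^n be lattice polytopes in the class Q_k. If dim(P + Q) ≥ 2^k, then the normalized volume Vol(P + Q) of the Minkowski sum is even. -/

import Mathlib

open Pointwise MeasureTheory

noncomputable section

/-- Standard dot product on `Fin n → ℝ`. -/
def dotR {n : ℕ} (c x : Fin n → ℝ) : ℝ := ∑ i, c i * x i

/-- The set of minimizers of the linear functional `x ↦ cᵀx` over `P`. -/
def argminSet {n : ℕ} (c : Fin n → ℝ) (P : Set (Fin n → ℝ)) : Set (Fin n → ℝ) :=
  {x ∈ P | ∀ y ∈ P, dotR c x ≤ dotR c y}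

/-- A polytope: the convex hull of a nonempty finite set of points. -/
def IsPolytope {n : ℕ} (P : Set (Fin n → ℝ)) : Prop :=
  ∃ V : Finset (Fin n → ℝ), V.Nonempty ∧ P = convexHull ℝ (V : Set (Fin n → ℝ))

/-- A lattice polytope: the convex hull of a nonempty finite set of integral points. -/
def IsLatticePolytope {n : ℕ} (P : Set (Fin n → ℝ)) : Prop :=
  ∃ V : Finset (Fin n → ℤ), V.Nonempty ∧
    P = convexHull ℝ ((fun v (i : Fin n) => ((v i : ℤ) : ℝ)) '' (V : Set (Fin n → ℤ)))

/-- `F` is a face of `P`: either the empty face or the set of minimizers of a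
linear functional over `P`. -/
def IsFace {n : ℕ} (P F : Set (Fin n → ℝ)) : Prop :=
  F = ∅ ∨ ∃ c : Fin n → ℝ, F = argminSet c P

/-- The dimension of a set: the rank of the direction space of its affine span. -/
def polyDim {n : ℕ} (P : Set (Fin n → ℝ)) : ℕ :=
  Module.finrank ℝ (affineSpan ℝ P).direction

/-- A point all of whose coordinates are integers. -/
def IsIntPt {m : ℕ} (x : Fin m → ℝ) : Prop := ∀ i, ∃ z : ℤ, x i = (z : ℝ)

/-- An affine chart identifying the affine hull of `P` with `ℝ^r` and mapping the induced
lattice of integral points bijectively onto `ℤ^r`. -/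
def IsLatticeChart {n r : ℕ} (P : Set (Fin n → ℝ))
    (φ : (Fin n → ℝ) →ᵃ[ℝ] (Fin r → ℝ)) : Prop :=
  Set.BijOn (fun x => φ x) (affineSpan ℝ P : Set (Fin n → ℝ)) Set.univ ∧
  ∀ x ∈ affineSpan ℝ P, (IsIntPt x ↔ IsIntPt (φ x))

open Classical in
/-- The normalized volume of a (rational) polytope `P`: `r!` times the Euclidean volume of
the image of `P` under a lattice-preserving affine chart of its affine hull (`r = dim P`).
This is well defined (independent of the chart) and integral for lattice polytopes. -/
def normVol {n : ℕ} (P : Set (Fin n → ℝ)) : ℝ :=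
  (Nat.factorial (polyDim P)) *
    (if h : ∃ φ : (Fin n → ℝ) →ᵃ[ℝ] (Fin (polyDim P) → ℝ), IsLatticeChart P φ
      then (volume ((fun x => h.choose x) '' P)).toReal
      else 0)

/-- The normalized volume is an even integer. -/
def EvenVol {n : ℕ} (P : Set (Fin n → ℝ)) : Prop := ∃ m : ℤ, normVol P = 2 * (m : ℝ)

/-- The class `Q_k`: lattice polytopes all of whose faces of dimension at least `2^k`
have even normalized volume. -/
def InQclass (k : ℕ) {n : ℕ} (P : Set (Fin n → ℝ)) : Prop :=
  IsLatticePolytope P ∧ ∀ F, IsFace P F → 2 ^ k ≤ polyDim F → EvenVol F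

/-- The classes `P_k` of lattice polytopes dual to `k`-hidden-layer integral ReLU networks:
`P_0` consists of single lattice points, and `P_{k+1}` consists of finite Minkowski sums of
convex hulls of unions of pairs of polytopes from `P_k`. -/
def InPclass {n : ℕ} : ℕ → Set (Fin n → ℝ) → Prop
  | 0, P => ∃ v : Fin n → ℤ, P = {fun i => ((v i : ℤ) : ℝ)}
  | k+1, P => ∃ (l : ℕ) (Q : Fin l → Set (Fin n → ℝ)), 0 < l ∧
      (∀ i, ∃ Q₁ Q₂ : Set (Fin n → ℝ), InPclass k Q₁ ∧ InPclass k Q₂ ∧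
        Q i = convexHull ℝ (Q₁ ∪ Q₂)) ∧
      P = ∑ i, Q i

/-- A (polyhedral) subdivision of `R`: a finite collection of polytopes covering `R`,
any two of which intersect in a common face. -/
def IsSubdivision {n : ℕ} (R : Set (Fin n → ℝ)) (𝒞 : Finset (Set (Fin n → ℝ))) : Prop :=
  (∀ C ∈ 𝒞, IsPolytope C) ∧
  (⋃ C ∈ 𝒞, C) = R ∧
  ∀ C ∈ 𝒞, ∀ D ∈ 𝒞, IsFace C (C ∩ D) ∧ IsFace D (C ∩ D)

/-- The standard simplex `Δ^n_0 = conv{0, e_1, …, e_n} ⊆ ℝ^n`. -/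
def stdSimplexPoly (n : ℕ) : Set (Fin n → ℝ) :=
  convexHull ℝ ({0} ∪ Set.range (fun i : Fin n => fun j => if j = i then (1 : ℝ) else 0))

theorem aux_support {E D : Type*} [NormedAddCommGroup E] [NormedSpace ℝ E] [FiniteDimensional ℝ E]
    [NormedAddCommGroup D] [NormedSpace ℝ D]
    (K : Set E) (hK : IsCompact K) (hKc : Convex ℝ K) (π : E →ₗ[ℝ] D) (v : E →ₗ[ℝ] ℝ)
    (x0 : E) (hx0 : x0 ∈ K) (hmin : ∀ y ∈ K, π y = π x0 → v x0 ≤ v y)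
    (hint : π x0 ∈ interior (π '' K)) :
    ∃ c : D →ₗ[ℝ] ℝ, ∀ y ∈ K, v x0 + c (π x0) ≤ v y + c (π y) := by
  set U : Set (D × ℝ) := {p | ∃ x ∈ K, π x = p.1 ∧ v x ≤ p.2} with hU
  have hUc : Convex ℝ U := by
    rintro p ⟨x, hx, hx1, hx2⟩ q ⟨y, hy, hy1, hy2⟩ a b ha hb hab
    refine ⟨a • x + b • y, hKc hx hy ha hb hab, ?_, ?_⟩
    · simp [hx1, hy1]
    · simp only [map_add, map_smul, smul_eq_mul, Prod.snd_add, Prod.smul_snd]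
      gcongr
  obtain ⟨B, hB⟩ := (hK.image (v.continuous_of_finiteDimensional)).bddAbove
  have hsub : interior (π '' K) ×ˢ Set.Ioi B ⊆ U := by
    rintro ⟨z, t⟩ ⟨hz, ht⟩
    obtain ⟨x, hx, rfl⟩ := interior_subset hz
    exact ⟨x, hx, rfl, (hB ⟨x, hx, rfl⟩).trans (le_of_lt ht)⟩
  have hUi : (interior U).Nonempty := by
    refine ⟨(π x0, B + 1), interior_maximal hsub (isOpen_interior.prod isOpen_Ioi) ⟨hint, ?_⟩⟩
    simp
  have hnot : (π x0, v x0) ∉ interior U := by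
    intro h
    have hcont : Filter.Tendsto (fun ε : ℝ => (π x0, v x0 - ε)) (nhds 0) (nhds (π x0, v x0)) := by
      have : Continuous (fun ε : ℝ => (π x0, v x0 - ε)) := by fun_prop
      simpa using this.tendsto 0
    have h1 := hcont.eventually (isOpen_interior.mem_nhds h)
    obtain ⟨δ, hδ, hball⟩ := Metric.eventually_nhds_iff.1 h1
    have h2 := interior_subset (hball (y := δ/2) (by simp [abs_of_pos hδ]; linarith))
    obtain ⟨x, hx, h3, h4⟩ := h2
    have := hmin x hx h3
    simp at h4
    linarith
  obtain ⟨f, u, hf0, hfU, hfu⟩ := geometric_hahn_banach_of_nonempty_interior hUc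
    (convex_singleton (π x0, v x0)) (Set.disjoint_singleton_right.2 hnot) hUi
    (Set.singleton_nonempty _)
  have hfu' := hfu _ rfl
  have hfa : ∀ z t, f (z, t) = f (z, 0) + t * f (0, 1) := by
    intro z t
    have : ((z, t) : D × ℝ) = (z, 0) + t • (0, 1) := by simp
    rw [this, map_add, map_smul, smul_eq_mul]
  have hle : ∀ x ∈ K, ∀ t, v x ≤ t → f (π x, 0) + t * f (0,1) ≤ f (π x0, 0) + v x0 * f (0,1) := by
    intro x hx t ht
    rw [← hfa, ← hfa]
    exact (hfU _ ⟨x, hx, rfl, ht⟩).trans hfu'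
  have hβ : f (0,1) ≤ 0 := by
    have := hle x0 hx0 (v x0 + 1) (by linarith)
    linarith
  have hβ' : f (0,1) < 0 := by
    refine lt_of_le_of_ne hβ fun h0 => hf0 ?_
    have hg : ∀ w, f (w, 0) ≤ 0 := by
      intro w
      have hcont : Filter.Tendsto (fun ε : ℝ => π x0 + ε • w) (nhds 0) (nhds (π x0)) := by
        have : Continuous (fun ε : ℝ => π x0 + ε • w) := by fun_prop
        simpa using this.tendsto 0
      have h1 := hcont.eventually (isOpen_interior.mem_nhds hint)
      obtain ⟨δ, hδ, hball⟩ := Metric.eventually_nhds_iff.1 h1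
      have h2 := interior_subset (hball (y := δ/2) (by simp [abs_of_pos hδ]; linarith))
      obtain ⟨x, hx, h3⟩ := h2
      have h4 := hle x hx _ le_rfl
      rw [h0, h3] at h4
      have h5 : ((π x0 + (δ/2) • w, 0) : D × ℝ) = (π x0, 0) + (δ/2) • (w, 0) := by simp
      rw [h5, map_add, map_smul, smul_eq_mul] at h4
      by_contra hc
      push Not at hc
      have : 0 < δ / 2 * f (w, 0) := by positivity
      linarith
    ext p
    · have h1 := hg p
      have h2 := hg (-p)
      have h3 : ((-p, 0) : D × ℝ) = -(p, 0) := by simp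
      rw [h3, map_neg] at h2
      simp; linarith
    · simp [h0]
  refine ⟨(f (0,1))⁻¹ • (f.toLinearMap ∘ₗ LinearMap.inl ℝ D ℝ), fun y hy => ?_⟩
  have := hle y hy _ le_rfl
  have hne0 := hβ'.ne
  simp only [LinearMap.smul_apply, LinearMap.comp_apply, LinearMap.inl_apply, smul_eq_mul]
  change v x0 + (f (0,1))⁻¹ * f (π x0, 0) ≤ v y + (f (0,1))⁻¹ * f (π y, 0)
  have e1 : v x0 + (f (0,1))⁻¹ * f (π x0, 0) = (f (0,1))⁻¹ * (f (π x0, 0) + v x0 * f (0,1)) := by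
    field_simp; ring
  have e2 : v y + (f (0,1))⁻¹ * f (π y, 0) = (f (0,1))⁻¹ * (f (π y, 0) + v y * f (0,1)) := by
    field_simp; ring
  rw [e1, e2]
  exact mul_le_mul_of_nonpos_left this (inv_nonpos.2 hβ)

/-- faces of hulls -/
theorem aux_face {E : Type*} [AddCommGroup E] [Module ℝ E] (V S : Finset E) (ℓ : E →ₗ[ℝ] ℝ)
    (hne : V.Nonempty)
    (hS : ∀ s, s ∈ S ↔ s ∈ V ∧ ∀ w ∈ V, ℓ s ≤ ℓ w) :
    S.Nonempty ∧ convexHull ℝ (S : Set E) =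
      {x ∈ convexHull ℝ (V : Set E) | ∀ y ∈ convexHull ℝ (V : Set E), ℓ x ≤ ℓ y} := by
  obtain ⟨s0, hs0, hs0m⟩ := V.exists_min_image ℓ hne
  have hs0S : s0 ∈ S := (hS s0).2 ⟨hs0, hs0m⟩
  refine ⟨⟨s0, hs0S⟩, ?_⟩
  have hlow : ∀ y ∈ convexHull ℝ (V : Set E), ℓ s0 ≤ ℓ y := by
    have : convexHull ℝ (V : Set E) ⊆ {y | ℓ s0 ≤ ℓ y} :=
      convexHull_min hs0m (convex_halfSpace_ge ℓ.isLinear _)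
    exact this
  apply Set.Subset.antisymm
  · intro x hx
    refine ⟨convexHull_mono (fun s hs => ((hS s).1 hs).1) hx, fun y hy => ?_⟩
    have : convexHull ℝ (S : Set E) ⊆ {y | ℓ y ≤ ℓ s0} :=
      convexHull_min (fun s hs => ((hS s).1 hs).2 s0 hs0) (convex_halfSpace_le ℓ.isLinear _)
    exact (this hx).trans (hlow y hy)
  · rintro x ⟨hx, hxm⟩
    have hx0 := hxm s0 (subset_convexHull _ _ hs0)
    obtain ⟨w, hw0, hw1, hwx⟩ := Finset.mem_convexHull'.1 hx
    have hz : ∀ y ∈ V, w y * (ℓ y - ℓ s0) = 0 := by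
      have hsum : ∑ y ∈ V, w y * (ℓ y - ℓ s0) = 0 := by
        apply le_antisymm
        · have : ∑ y ∈ V, w y * (ℓ y - ℓ s0) = ℓ x - ℓ s0 := by
            simp only [mul_sub, Finset.sum_sub_distrib, ← Finset.sum_mul, hw1, ← hwx, map_sum,
              map_smul, smul_eq_mul, one_mul]
          linarith
        · exact Finset.sum_nonneg fun y hy => mul_nonneg (hw0 y hy) (by linarith [hs0m y hy])
      exact (Finset.sum_eq_zero_iff_of_nonneg
        fun y hy => mul_nonneg (hw0 y hy) (by linarith [hs0m y hy])).1 hsum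
    have hz' : ∀ y ∈ V, y ∉ S → w y = 0 := by
      intro y hy hyS
      rcases mul_eq_zero.1 (hz y hy) with h | h
      · exact h
      · exact absurd ((hS y).2 ⟨hy, fun u hu => by linarith [hs0m u hu]⟩) hyS
    have hSV : S ⊆ V := fun s hs => ((hS s).1 hs).1
    refine Finset.mem_convexHull'.2 ⟨w, fun y hy => hw0 y (hSV hy), ?_, ?_⟩
    · rw [← hw1]; exact Finset.sum_subset hSV hz'
    · rw [← hwx]; exact Finset.sum_subset hSV fun y hy h => by rw [hz' y hy h, zero_smul]

open Classical in
theorem aux_cells {E : Type*} [NormedAddCommGroup E] [NormedSpace ℝ E] [FiniteDimensional ℝ E]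
    {d : ℕ} (V : Finset E) (hne : V.Nonempty) (π : E →ₗ[ℝ] (Fin d → ℝ)) :
    ∃ Φ : Finset (Finset E),
      (∀ S ∈ Φ, S ⊆ V ∧ S.Nonempty ∧ Disjoint (vectorSpan ℝ (S : Set E)) (LinearMap.ker π) ∧
        ∃ ℓ : E →ₗ[ℝ] ℝ, convexHull ℝ (S : Set E) =
          {x ∈ convexHull ℝ (V : Set E) | ∀ y ∈ convexHull ℝ (V : Set E), ℓ x ≤ ℓ y}) ∧
      volume (π '' convexHull ℝ (V : Set E)) = ∑ S ∈ Φ, volume (π '' convexHull ℝ (S : Set E)) := by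
  -- generic functional
  let I := {S : Finset E // S ∈ V.powerset ∧ ¬ Disjoint (vectorSpan ℝ (S : Set E)) (LinearMap.ker π)}
  have : Finite I := Finite.of_injective (β := {S // S ∈ V.powerset})
    (fun S => ⟨S.1, S.2.1⟩) (fun a b h => Subtype.ext (by simpa using h))
  have hu : ∀ S : I, ∃ u : E, u ∈ vectorSpan ℝ (S.1 : Set E) ∧ u ∈ LinearMap.ker π ∧ u ≠ 0 := by
    intro S
    have h := S.2.2
    rw [Submodule.disjoint_def] at h
    push Not at h
    exact h
  choose u hu1 hu2 hu3 using hu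
  obtain ⟨v, hv⟩ := Module.exists_dual_forall_apply_ne_zero (K := ℝ) u hu3
  set K := convexHull ℝ (V : Set E) with hKdef
  have hKcomp : IsCompact K := V.finite_toSet.isCompact_convexHull (𝕜 := ℝ)
  have hKc : Convex ℝ K := convex_convexHull _ _
  let ℓ : ((Fin d → ℝ) →ₗ[ℝ] ℝ) → (E →ₗ[ℝ] ℝ) := fun c => v + c ∘ₗ π
  let Sc : ((Fin d → ℝ) →ₗ[ℝ] ℝ) → Finset E := fun c => V.filter fun s => ∀ w ∈ V, ℓ c s ≤ ℓ c w
  have hface := fun c => aux_face V (Sc c) (ℓ c) hne (fun s => by simp [Sc])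
  have hScV : ∀ c, Sc c ⊆ V := fun c => Finset.filter_subset _ _
  have hdisj : ∀ c, Disjoint (vectorSpan ℝ (Sc c : Set E)) (LinearMap.ker π) := by
    intro c
    by_contra hcon
    let S : I := ⟨Sc c, Finset.mem_powerset.2 (hScV c), hcon⟩
    have h1 : vectorSpan ℝ (Sc c : Set E) ≤ LinearMap.ker (ℓ c) := by
      rw [vectorSpan_def, Submodule.span_le]
      rintro _ ⟨a, ha, b, hb, rfl⟩
      have ha := (Finset.mem_filter.1 ha)
      have hb := (Finset.mem_filter.1 hb)
      have := le_antisymm (ha.2 b hb.1) (hb.2 a ha.1)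
      simp only [vsub_eq_sub, SetLike.mem_coe, LinearMap.mem_ker, map_sub, this, sub_self]
    have h2 : ℓ c (u S) = 0 := h1 (hu1 S)
    have h3 : π (u S) = 0 := hu2 S
    simp only [ℓ, LinearMap.add_apply, LinearMap.comp_apply, h3, map_zero, add_zero] at h2
    exact hv S h2
  refine ⟨V.powerset.filter fun S => ∃ c, S = Sc c, ?_, ?_⟩
  · intro S hS
    obtain ⟨-, c, rfl⟩ := Finset.mem_filter.1 hS
    exact ⟨hScV c, (hface c).1, hdisj c, ℓ c, (hface c).2⟩
  have hcomp : ∀ S : Finset E, IsCompact (π '' convexHull ℝ (S : Set E)) := fun S =>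
    (S.finite_toSet.isCompact_convexHull (𝕜 := ℝ)).image π.continuous_of_finiteDimensional
  rw [← measure_biUnion_finset₀]
  · -- covering
    apply le_antisymm
    · have hsub : π '' K ⊆ (⋃ S ∈ V.powerset.filter fun S => ∃ c, S = Sc c,
          π '' convexHull ℝ (S : Set E)) ∪ frontier (π '' K) := by
        intro z hz
        by_cases hzi : z ∈ interior (π '' K)
        · left
          have hfc : IsCompact (K ∩ π ⁻¹' {z}) :=
            hKcomp.inter_right (isClosed_singleton.preimage π.continuous_of_finiteDimensional)
          obtain ⟨x, hxK, hxz⟩ := hz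
          obtain ⟨x0, ⟨hx0K, hx0z⟩, hx0min⟩ := hfc.exists_isMinOn ⟨x, hxK, hxz⟩
            v.continuous_of_finiteDimensional.continuousOn
          have hx0z' : π x0 = z := hx0z
          subst hx0z'
          obtain ⟨c, hc⟩ := aux_support K hKcomp hKc π v x0 hx0K
            (fun y hy hyx => hx0min ⟨hy, hyx⟩) hzi
          simp only [Set.mem_iUnion]
          refine ⟨Sc c, Finset.mem_filter.2 ⟨Finset.mem_powerset.2 (hScV c), c, rfl⟩, x0, ?_, rfl⟩
          rw [(hface c).2]
          exact ⟨hx0K, hc⟩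
        · right
          exact ⟨subset_closure hz, hzi⟩
      refine (measure_mono hsub).trans ((measure_union_le _ _).trans ?_)
      rw [(hKc.linear_image π).addHaar_frontier volume, add_zero]
    · refine measure_mono ?_
      intro z hz
      simp only [Set.mem_iUnion] at hz
      obtain ⟨S, hS, x, hx, rfl⟩ := hz
      exact ⟨x, convexHull_mono (Finset.coe_subset.2 (Finset.mem_powerset.1 (Finset.mem_filter.1 hS).1)) hx, rfl⟩
  · -- disjointness
    have key : ∀ c c', (∃ s ∈ Sc c, s ∉ Sc c') →
        volume (π '' convexHull ℝ (Sc c : Set E) ∩ π '' convexHull ℝ (Sc c' : Set E)) = 0 := by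
      rintro c c' ⟨s, hs, hs'⟩
      have hsV := hScV c hs
      have hsK : s ∈ K := subset_convexHull _ _ hsV
      obtain ⟨s', hsS'⟩ := (hface c').1
      have hs'K : s' ∈ K := subset_convexHull _ _ (hScV c' hsS')
      have hsf : s ∈ convexHull ℝ (Sc c : Set E) := subset_convexHull _ _ hs
      have hsf' : s' ∈ convexHull ℝ (Sc c' : Set E) := subset_convexHull _ _ hsS'
      rw [(hface c).2] at hsf
      rw [(hface c').2] at hsf'
      have hlt : ℓ c' s' < ℓ c' s := by
        by_contra hcon
        push Not at hcon
        exact hs' (Finset.mem_filter.2 ⟨hsV, fun w hw =>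
          hcon.trans (hsf'.2 w (subset_convexHull _ _ hw))⟩)
      have hinc : π '' convexHull ℝ (Sc c : Set E) ∩ π '' convexHull ℝ (Sc c' : Set E) ⊆
          {z | (c' - c) z = ℓ c' s' - ℓ c s} := by
        rintro z ⟨⟨x, hx, rfl⟩, ⟨y, hy, hyx⟩⟩
        rw [(hface c).2] at hx
        rw [(hface c').2] at hy
        have h1 := hx.2 y hy.1
        have h2 := hy.2 x hx.1
        have h3 := le_antisymm (hx.2 s hsK) (hsf.2 x hx.1)
        have h4 := le_antisymm (hy.2 s' hs'K) (hsf'.2 y hy.1)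
        simp only [ℓ, LinearMap.add_apply, LinearMap.comp_apply, hyx] at h1 h2 h3 h4 ⊢
        simp only [Set.mem_ofPred_eq, LinearMap.sub_apply]
        linarith
      have hgs : (c' - c) (π s) ≠ ℓ c' s' - ℓ c s := by
        simp only [ℓ, LinearMap.add_apply, LinearMap.comp_apply, LinearMap.sub_apply] at hlt ⊢
        intro h
        linarith
      refine measure_mono_null hinc ?_
      set m := ℓ c' s' - ℓ c s
      let A : AffineSubspace ℝ (Fin d → ℝ) :=
        AffineSubspace.comap (c' - c).toAffineMap (AffineSubspace.mk' m ⊥)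
      have hA : (A : Set (Fin d → ℝ)) = {z | (c' - c) z = m} := by
        ext z; simp [A, AffineSubspace.mem_mk', sub_eq_zero]
      rw [← hA]
      refine Measure.addHaar_affineSubspace _ _ ?_
      intro htop
      apply hgs
      have : π s ∈ (A : Set (Fin d → ℝ)) := by rw [htop]; trivial
      rw [hA] at this
      exact this
    intro S hS T hT hST
    obtain ⟨-, c, rfl⟩ := Finset.mem_filter.1 hS
    obtain ⟨-, c', rfl⟩ := Finset.mem_filter.1 hT
    change volume (_ ∩ _) = 0
    by_cases h : Sc c ⊆ Sc c'
    · have h' : ¬ Sc c' ⊆ Sc c := fun h' => hST (Finset.Subset.antisymm h h')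
      rw [Set.inter_comm]
      exact key c' c (Finset.not_subset.1 h')
    · exact key c c' (Finset.not_subset.1 h)
  · intro S _
    exact (hcomp S).isClosed.measurableSet.nullMeasurableSet

def cornerS (r : ℕ) : Set (Fin r → ℝ) :=
  convexHull ℝ (insert 0 (Set.range fun i : Fin r => (Pi.single i 1 : Fin r → ℝ)))

theorem cornerS_eq (r : ℕ) : cornerS r = {x | ∑ i, |x i| ≤ 1 ∧ ∀ i, 0 ≤ x i} := by
  apply Set.Subset.antisymm
  · have hset : {x : Fin r → ℝ | ∑ i, |x i| ≤ 1 ∧ ∀ i, 0 ≤ x i} =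
        {x : Fin r → ℝ | ∑ i, x i ≤ 1 ∧ ∀ i, 0 ≤ x i} := by
      ext x
      simp only [Set.mem_ofPred_eq]
      refine and_congr_left fun h => ?_
      simp [abs_of_nonneg (h _)]
    rw [hset]
    refine convexHull_min ?_ ?_
    · rintro x (rfl | ⟨i, rfl⟩)
      · simp
      · refine ⟨by simp, fun j => ?_⟩
        by_cases h : j = i
        · subst h; simp
        · simp [h]
    · rintro x ⟨hx1, hx2⟩ y ⟨hy1, hy2⟩ a b ha hb hab
      refine ⟨?_, fun i => ?_⟩
      · simp only [Pi.add_apply, Pi.smul_apply, smul_eq_mul, Finset.sum_add_distrib,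
          ← Finset.mul_sum]
        nlinarith
      · have := hx2 i
        have := hy2 i
        simp only [Pi.add_apply, Pi.smul_apply, smul_eq_mul]
        positivity
  · rintro x ⟨hx1, hx2⟩
    have hx1' : ∑ i, x i ≤ 1 := by simpa [abs_of_nonneg (hx2 _)] using hx1
    let w : Option (Fin r) → ℝ := fun o => o.elim (1 - ∑ i, x i) x
    let z : Option (Fin r) → (Fin r → ℝ) := fun o => o.elim 0 (fun i => Pi.single i 1)
    have h := (convex_convexHull ℝ (insert 0 (Set.range fun i : Fin r => (Pi.single i 1 : Fin r → ℝ)))).sum_mem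
      (t := Finset.univ) (w := w) (z := z) ?_ ?_ ?_
    · have e : ∑ i, w i • z i = x := by
        simp only [Fintype.sum_option, w, z, Option.elim]
        simp only [smul_zero, zero_add]
        ext j
        simp [Finset.sum_apply, Pi.single_apply]
      rw [e] at h
      exact h
    · rintro (_ | i) _
      · simp [w, hx1']
      · exact hx2 i
    · simp [Fintype.sum_option, w]
    · rintro (_ | i) _
      · exact subset_convexHull _ _ (Or.inl rfl)
      · exact subset_convexHull _ _ (Or.inr ⟨i, rfl⟩)

theorem volume_cornerS (r : ℕ) : (volume (cornerS r)).toReal * r.factorial = 1 := by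
  rcases Nat.eq_zero_or_pos r with rfl | hr
  · have : cornerS 0 = Set.univ := by
      rw [cornerS_eq]; ext x; simp
    rw [this]
    simp [volume_pi]
  have : Nonempty (Fin r) := ⟨⟨0, hr⟩⟩
  let sg : (Fin r → Bool) → Fin r → ℝ := fun ε i => if ε i then 1 else -1
  have hsg : ∀ ε i, |sg ε i| = 1 := by
    intro ε i; simp only [sg]; split_ifs <;> simp
  let O : (Fin r → Bool) → Set (Fin r → ℝ) := fun ε =>
    {x | ∑ i, |x i| ≤ 1 ∧ ∀ i, 0 ≤ sg ε i * x i}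
  let Lm : (Fin r → Bool) → ((Fin r → ℝ) →ₗ[ℝ] (Fin r → ℝ)) := fun ε =>
    Matrix.toLin' (Matrix.diagonal (sg ε))
  have hO : ∀ ε, O ε = Lm ε ⁻¹' (cornerS r) := by
    intro ε
    rw [cornerS_eq]
    ext x
    simp [O, Lm, Matrix.mulVec_diagonal, abs_mul, hsg]
  have hdet : ∀ ε, |LinearMap.det (Lm ε)| = 1 := by
    intro ε
    simp [Lm, Matrix.det_diagonal, Finset.abs_prod, hsg]
  have hvol : ∀ ε, volume (O ε) = volume (cornerS r) := by
    intro ε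
    rw [hO, Measure.addHaar_preimage_linearMap]
    · rw [abs_inv, hdet]; simp
    · intro h
      have := hdet ε
      rw [h] at this
      simp at this
  have hcl : IsClosed (cornerS r) :=
    ((Set.finite_range _).insert _).isClosed_convexHull ℝ
  have hOm : ∀ ε, MeasurableSet (O ε) := by
    intro ε
    rw [hO]
    exact (hcl.preimage (Lm ε).continuous_of_finiteDimensional).measurableSet
  have hU : (⋃ ε ∈ (Finset.univ : Finset (Fin r → Bool)), O ε) = {x | ∑ i, |x i| ≤ 1} := by
    ext x
    simp only [Finset.mem_univ, Set.iUnion_true, Set.mem_iUnion, O, Set.mem_ofPred_eq]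
    constructor
    · rintro ⟨_, h, _⟩; exact h
    · intro h
      refine ⟨fun i => decide (0 ≤ x i), h, fun i => ?_⟩
      by_cases hi : 0 ≤ x i
      · simp [sg, hi]
      · simp [sg, hi]; linarith
  have hball := MeasureTheory.volume_sum_rpow_le (Fin r) (p := 1) le_rfl 1
  have hset : {x : Fin r → ℝ | (∑ i, |x i| ^ (1:ℝ)) ^ (1 / (1:ℝ)) ≤ 1} = {x | ∑ i, |x i| ≤ 1} := by
    simp
  rw [hset, ← hU, measure_biUnion_finset₀] at hball
  · simp only [hvol, Finset.sum_const, Finset.card_univ, Fintype.card_pi, Fintype.card_bool,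
      Finset.prod_const, Fintype.card_fin] at hball
    have h2 := congrArg ENNReal.toReal hball
    rw [nsmul_eq_mul, ENNReal.toReal_mul] at h2
    have g2 : Real.Gamma (1 / 1 + 1) = 1 := by
      rw [show (1 / 1 + 1 : ℝ) = 2 by norm_num, Real.Gamma_two]
    have g3 : Real.Gamma ((r : ℝ) / 1 + 1) = r.factorial := by
      rw [div_one, Real.Gamma_nat_eq_factorial]
    rw [g2, g3] at h2
    simp only [ENNReal.ofReal_one, one_pow, one_mul, mul_one, Nat.cast_pow, Nat.cast_ofNat, ENNReal.toReal_pow,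
      ENNReal.toReal_ofNat] at h2
    rw [ENNReal.toReal_ofReal (by positivity)] at h2
    field_simp at h2
    exact h2
  · intro ε _ δ _ hne
    obtain ⟨i, hi⟩ := Function.ne_iff.1 hne
    change volume (O ε ∩ O δ) = 0
    have hinc : O ε ∩ O δ ⊆ (LinearMap.ker (LinearMap.proj i : (Fin r → ℝ) →ₗ[ℝ] ℝ) : Set (Fin r → ℝ)) := by
      rintro x ⟨⟨_, h1⟩, ⟨_, h2⟩⟩
      have h1 := h1 i
      have h2 := h2 i
      simp only [sg] at h1 h2
      simp only [SetLike.mem_coe, LinearMap.mem_ker, LinearMap.proj_apply]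
      cases hε : ε i <;> cases hδ : δ i <;> simp [hε, hδ] at h1 h2 hi <;> linarith
    refine measure_mono_null hinc (Measure.addHaar_submodule _ _ ?_)
    intro htop
    have : (Pi.single i 1 : Fin r → ℝ) ∈ (LinearMap.ker (LinearMap.proj i : (Fin r → ℝ) →ₗ[ℝ] ℝ)) := by
      rw [htop]; trivial
    simp at this
  · intro ε _
    exact (hOm ε).nullMeasurableSet

theorem det_int {r : ℕ} (B : (Fin r → ℝ) →ₗ[ℝ] (Fin r → ℝ))
    (h : ∀ j i, ∃ z : ℤ, B (Pi.single j 1) i = z) : ∃ z : ℤ, |LinearMap.det B| = z := by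
  choose z hz using h
  let M : Matrix (Fin r) (Fin r) ℤ := Matrix.of fun i j => z j i
  have hM : LinearMap.toMatrix' B = (Int.castRingHom ℝ).mapMatrix M := by
    ext i j
    simp [LinearMap.toMatrix'_apply, hz, M]
  refine ⟨|M.det|, ?_⟩
  rw [← LinearMap.det_toMatrix', hM, ← RingHom.map_det]
  simp

theorem simplex_int {r : ℕ} (T : Fin (r + 1) → (Fin r → ℝ)) (hT : ∀ k i, ∃ z : ℤ, T k i = z) :
    ∃ m : ℤ, (r.factorial : ℝ) * (volume (convexHull ℝ (Set.range T))).toReal = m := by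
  let B : (Fin r → ℝ) →ₗ[ℝ] (Fin r → ℝ) := Fintype.linearCombination ℝ (fun j : Fin r => T j.succ - T 0)
  have hB : ∀ j, B (Pi.single j 1) = T j.succ - T 0 := by
    intro j; simp [B]
  obtain ⟨z, hz⟩ := det_int B (by
    intro j i
    obtain ⟨a, ha⟩ := hT j.succ i
    obtain ⟨b, hb⟩ := hT 0 i
    exact ⟨a - b, by rw [hB]; simp [ha, hb]⟩)
  have himg : convexHull ℝ (Set.range T) = (fun x => T 0 + x) '' (B '' cornerS r) := by
    have h1 : B '' cornerS r = convexHull ℝ (B '' _) := B.image_convexHull _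
    have h2 := (AffineMap.const ℝ (Fin r → ℝ) (T 0) + AffineMap.id ℝ (Fin r → ℝ)).image_convexHull
      (B '' (insert 0 (Set.range fun i : Fin r => (Pi.single i 1 : Fin r → ℝ))))
    rw [h1]
    refine Eq.trans ?_ h2.symm
    congr 1
    ext x
    simp only [Set.image_insert_eq, map_zero, ← Set.range_comp, Function.comp_def, hB]
    rw [Fin.range_fin_succ]
    simp [Fin.tail, Function.comp_def]
  refine ⟨z, ?_⟩
  rw [himg, Set.image_add_left, measure_preimage_add, Measure.addHaar_image_linearMap,
    ENNReal.toReal_mul, ENNReal.toReal_ofReal (abs_nonneg _), hz]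
  have := volume_cornerS r
  calc (r.factorial : ℝ) * (z * (volume (cornerS r)).toReal) = z * ((volume (cornerS r)).toReal * r.factorial) := by ring
    _ = z := by rw [this, mul_one]

theorem poly_int {r : ℕ} (V : Finset (Fin r → ℝ)) (hne : V.Nonempty)
    (hV : ∀ v ∈ V, ∀ i, ∃ z : ℤ, v i = z) :
    ∃ m : ℤ, (r.factorial : ℝ) * (volume (convexHull ℝ (V : Set (Fin r → ℝ)))).toReal = m := by
  classical
  let π : (V → ℝ) →ₗ[ℝ] (Fin r → ℝ) := Fintype.linearCombination ℝ (fun v : V => (v : Fin r → ℝ))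
  let f : V → (V → ℝ) := fun v => Pi.single v 1
  have hπ : ∀ v, π (f v) = v := by intro v; simp [π, f]
  let V' : Finset (V → ℝ) := Finset.univ.image f
  have hV' : ∀ s ∈ V', ∃ v, f v = s := by intro s hs; simpa [V'] using hs
  have : Nonempty V := hne.to_subtype
  obtain ⟨Φ, hΦ, hvol⟩ := aux_cells V' (Finset.univ_nonempty.image f) π
  have himg : π '' convexHull ℝ (V' : Set (V → ℝ)) = convexHull ℝ (V : Set (Fin r → ℝ)) := by
    rw [π.image_convexHull]
    congr 1
    ext x
    simp [V', hπ]
  rw [himg] at hvol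
  have hfin : ∀ S : Finset (V → ℝ), volume (π '' convexHull ℝ (S : Set (V → ℝ))) ≠ ⊤ := fun S =>
    ((S.finite_toSet.isCompact_convexHull ℝ).image π.continuous_of_finiteDimensional).measure_lt_top.ne
  rw [hvol, ENNReal.toReal_sum (fun S _ => hfin S), Finset.mul_sum]
  have hint : ∀ S ∈ Φ, ∃ m : ℤ, (r.factorial : ℝ) *
      (volume (π '' convexHull ℝ (S : Set (V → ℝ)))).toReal = m := by
    intro S hS
    obtain ⟨hSV, hSne, hdis, -⟩ := hΦ S hS
    have hπS : ∀ s ∈ S, ∀ i, ∃ z : ℤ, π s i = z := by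
      intro s hs i
      obtain ⟨v, rfl⟩ := hV' s (hSV hs)
      rw [hπ]
      exact hV v v.2 i
    have hcardpos := hSne.card_pos
    have hai : AffineIndependent ℝ (Subtype.val : ↥(S : Set (V → ℝ)) → (V → ℝ)) := by
      have h1 : LinearIndependent ℝ f := by
        exact Pi.linearIndependent_single_one V ℝ
      refine (h1.affineIndependent.range).mono ?_
      intro s hs
      exact hV' s (hSV hs)
    have hrank : Module.finrank ℝ (vectorSpan ℝ (S : Set (V → ℝ))) = S.card - 1 := by
      have : Fintype.card ↥(S : Set (V → ℝ)) = (S.card - 1) + 1 := by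
        simp; omega
      have h := hai.finrank_vectorSpan this
      rwa [Subtype.range_coe] at h
    have hle : Module.finrank ℝ (vectorSpan ℝ (S : Set (V → ℝ))) ≤ r := by
      have hinj : Function.Injective (π.domRestrict (vectorSpan ℝ (S : Set (V → ℝ)))) := by
        rw [← LinearMap.ker_eq_bot, LinearMap.ker_eq_bot']
        rintro ⟨x, hx⟩ h0
        exact Subtype.ext (Submodule.disjoint_def.1 hdis x hx h0)
      simpa using LinearMap.finrank_le_finrank_of_injective hinj
    rw [π.image_convexHull]
    rcases lt_or_eq_of_le hle with hlt | heq
    · refine ⟨0, ?_⟩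
      have h0 : volume (convexHull ℝ (π '' (S : Set (V → ℝ)))) = 0 := by
        refine measure_mono_null (convexHull_subset_affineSpan _) (Measure.addHaar_affineSubspace _ _ ?_)
        intro htop
        have h1 := finrank_vectorSpan_image_finset_le ℝ π S (n := S.card - 1) (by omega)
        rw [← direction_affineSpan, Finset.coe_image, htop, AffineSubspace.direction_top, finrank_top] at h1
        simp at h1
        omega
      rw [h0]; simp
    · have hc : S.card = r + 1 := by omega
      let e := S.equivFinOfCardEq hc
      obtain ⟨m, hm⟩ := simplex_int (fun k => π (e.symm k : V → ℝ)) (fun k i => hπS _ (e.symm k).2 i)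
      refine ⟨m, ?_⟩
      rw [← hm]
      congr 4
      ext x
      constructor
      · rintro ⟨s, hs, rfl⟩
        exact ⟨e ⟨s, hs⟩, by simp⟩
      · rintro ⟨k, rfl⟩
        exact ⟨_, (e.symm k).2, rfl⟩
  choose! m hm using hint
  exact ⟨∑ S ∈ Φ, m S, by rw [Finset.sum_congr rfl hm]; simp⟩

theorem choose_even {k i j : ℕ} (hi : i < 2 ^ k) (hj : j < 2 ^ k) (h : 2 ^ k ≤ i + j) :
    2 ∣ (i + j).choose i := by
  have h2 : Fact (Nat.Prime 2) := ⟨Nat.prime_two⟩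
  have hk : 1 ≤ k := by
    rcases Nat.eq_zero_or_pos k with rfl | h
    · simp at hi hj h; omega
    · exact h
  have hv := padicValNat_choose' (p := 2) (n := j) (k := i) (b := Nat.log 2 (j + i) + k + 1) (by omega)
  rw [add_comm i j]
  have : padicValNat 2 ((j + i).choose i) ≠ 0 := by
    rw [hv]
    apply Finset.card_ne_zero_of_mem (a := k)
    simp only [Finset.mem_filter, Finset.mem_Ico]
    refine ⟨⟨hk, by omega⟩, ?_⟩
    rw [Nat.mod_eq_of_lt hi, Nat.mod_eq_of_lt hj]; exact h
  exact dvd_of_one_le_padicValNat (by omega)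

theorem IsIntPt.add' {m : ℕ} {x y : Fin m → ℝ} (hx : IsIntPt x) (hy : IsIntPt y) : IsIntPt (x + y) := by
  intro i
  obtain ⟨a, ha⟩ := hx i
  obtain ⟨b, hb⟩ := hy i
  exact ⟨a + b, by simp [ha, hb]⟩

theorem IsIntPt.sub' {m : ℕ} {x y : Fin m → ℝ} (hx : IsIntPt x) (hy : IsIntPt y) : IsIntPt (x - y) := by
  intro i
  obtain ⟨a, ha⟩ := hx i
  obtain ⟨b, hb⟩ := hy i
  exact ⟨a - b, by simp [ha, hb]⟩

theorem chart_exists {n : ℕ} (V : Finset (Fin n → ℝ)) (hne : V.Nonempty) (hV : ∀ v ∈ V, IsIntPt v)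
    (P : Set (Fin n → ℝ)) (hP : P = convexHull ℝ (V : Set (Fin n → ℝ))) :
    ∃ φ : (Fin n → ℝ) →ᵃ[ℝ] (Fin (polyDim P) → ℝ), IsLatticeChart P φ := by
  have haff : affineSpan ℝ P = affineSpan ℝ (V : Set (Fin n → ℝ)) := by
    rw [hP, affineSpan_convexHull]
  obtain ⟨p, hp⟩ := hne
  have hpV := hV p hp
  have hpA : p ∈ affineSpan ℝ P := by rw [haff]; exact mem_affineSpan ℝ hp
  set W := (affineSpan ℝ P).direction with hW
  let L0 : Submodule ℤ (Fin n → ℝ) := Submodule.span ℤ (Set.range (Pi.basisFun ℝ (Fin n)))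
  have hL0 : ∀ x, x ∈ L0 ↔ IsIntPt x := by
    intro x
    simp only [L0]
    rw [Module.Basis.mem_span_iff_repr_mem]
    simp [IsIntPt, eq_comm]
  let L : Submodule ℤ W := ZLattice.comap ℝ L0 W.subtype
  have hL : ∀ x : W, x ∈ L ↔ IsIntPt (x : Fin n → ℝ) := fun x => hL0 x
  have : DiscreteTopology L := ZLattice.comap_discreteTopology ℝ L0
    W.subtype.continuous_of_finiteDimensional W.injective_subtype
  have hspan : Submodule.span ℝ (L : Set W) = ⊤ := by
    have h1 : Submodule.map W.subtype (Submodule.span ℝ (L : Set W)) = W := by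
      apply le_antisymm (Submodule.map_subtype_le _ _)
      conv_lhs => rw [hW, haff, direction_affineSpan,
        vectorSpan_eq_span_vsub_set_right ℝ (Finset.mem_coe.2 hp)]
      rw [Submodule.span_le]
      rintro _ ⟨v, hv, rfl⟩
      have hvW : v -ᵥ p ∈ W := AffineSubspace.vsub_mem_direction
        (by rw [haff]; exact mem_affineSpan ℝ hv) hpA
      refine ⟨⟨v -ᵥ p, hvW⟩, Submodule.subset_span ?_, rfl⟩
      exact (hL _).2 ((hV v hv).sub' hpV)
    rw [eq_top_iff]
    intro x _
    have : (x : Fin n → ℝ) ∈ Submodule.map W.subtype (Submodule.span ℝ (L : Set W)) := by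
      rw [h1]; exact x.2
    obtain ⟨y, hy, hyx⟩ := this
    have : y = x := Subtype.ext hyx
    rwa [← this]
  have : IsZLattice ℝ L := ⟨hspan⟩
  have := ZLattice.module_free ℝ L
  have := ZLattice.module_finite ℝ L
  let b0 := (Module.Free.chooseBasis ℤ L).ofZLatticeBasis ℝ L
  have hb0 : Submodule.span ℤ (Set.range b0) = L := Module.Basis.ofZLatticeBasis_span ℝ L _
  let e : Module.Free.ChooseBasisIndex ℤ L ≃ Fin (polyDim P) :=
    Fintype.equivFinOfCardEq (by
      rw [polyDim, Module.finrank_eq_card_basis b0])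
  let b := b0.reindex e
  have hb : Submodule.span ℤ (Set.range b) = L := by
    rw [← hb0]; simp [b]
  obtain ⟨g, hg⟩ := LinearMap.exists_extend (p := W) (b.equivFun : W →ₗ[ℝ] (Fin (polyDim P) → ℝ))
  have hgW : ∀ w : W, g w = b.equivFun w := fun w => LinearMap.congr_fun hg w
  have hφ : ∀ x, (g.toAffineMap - AffineMap.const ℝ (Fin n → ℝ) (g p)) x = g (x - p) := by
    intro x; simp
  have hxW : ∀ x ∈ affineSpan ℝ P, x - p ∈ W := fun x hx => AffineSubspace.vsub_mem_direction hx hpA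
  refine ⟨g.toAffineMap - AffineMap.const ℝ (Fin n → ℝ) (g p), ⟨fun _ _ => trivial, ?_, ?_⟩, ?_⟩
  · intro x hx y hy hxy
    simp only [hφ] at hxy
    have h1 := hgW ⟨x - p, hxW x hx⟩
    have h2 := hgW ⟨y - p, hxW y hy⟩
    simp only at h1 h2
    rw [h1, h2] at hxy
    have := congrArg Subtype.val (b.equivFun.injective hxy)
    simpa using this
  · intro s _
    refine ⟨(b.equivFun.symm s : W) + p, ?_, ?_⟩
    · exact AffineSubspace.vadd_mem_of_mem_direction (b.equivFun.symm s).2 hpA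
    · simp only [hφ]
      rw [add_sub_cancel_right, hgW]
      exact b.equivFun.apply_symm_apply s
  · intro x hx
    rw [hφ]
    have h1 := hgW ⟨x - p, hxW x hx⟩
    simp only at h1
    rw [h1]
    have h2 : IsIntPt x ↔ IsIntPt (x - p) :=
      ⟨fun h => h.sub' hpV, fun h => by simpa using h.add' hpV⟩
    rw [h2]
    have h3 := hL ⟨x - p, hxW x hx⟩
    simp only at h3
    rw [← h3, ← hb, Module.Basis.mem_span_iff_repr_mem]
    simp [IsIntPt, eq_comm]

theorem chart_inv {n r : ℕ} (P : Set (Fin n → ℝ)) (hne : P.Nonempty)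
    (φ : (Fin n → ℝ) →ᵃ[ℝ] (Fin r → ℝ)) (hφ : IsLatticeChart P φ) :
    ∃ ψ : (Fin r → ℝ) →ᵃ[ℝ] (Fin n → ℝ), (∀ s, ψ s ∈ affineSpan ℝ P) ∧ (∀ s, φ (ψ s) = s) ∧
      (∀ x ∈ affineSpan ℝ P, ψ (φ x) = x) ∧ (∀ s, IsIntPt s → IsIntPt (ψ s)) := by
  have : Nonempty (affineSpan ℝ P) := ((affineSpan_nonempty ℝ).2 hne).to_subtype
  let φ' : affineSpan ℝ P →ᵃ[ℝ] (Fin r → ℝ) := φ.comp (affineSpan ℝ P).subtype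
  have hbij : Function.Bijective φ' := by
    constructor
    · intro x y h
      exact Subtype.ext (hφ.1.injOn x.2 y.2 h)
    · intro s
      obtain ⟨x, hx, h⟩ := hφ.1.surjOn (Set.mem_univ s)
      exact ⟨⟨x, hx⟩, h⟩
  let e := AffineEquiv.ofBijective hbij
  have he : ∀ x : affineSpan ℝ P, e x = φ x := fun x => rfl
  have h1 : ∀ s, φ (e.symm s : Fin n → ℝ) = s := by
    intro s
    rw [← he]; simp
  refine ⟨(affineSpan ℝ P).subtype.comp e.symm.toAffineMap, ?_, ?_, ?_, ?_⟩
  · intro s; exact (e.symm s).2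
  · exact h1
  · intro x hx
    have h2 : φ x = e ⟨x, hx⟩ := rfl
    simp [h2]
  · intro s hs
    refine (hφ.2 _ (e.symm s).2).2 ?_
    rw [h1]; exact hs

theorem prod_vol {i j : ℕ} (α : (Fin i → ℝ) →ₗ[ℝ] (Fin (i + j) → ℝ))
    (β : (Fin j → ℝ) →ₗ[ℝ] (Fin (i + j) → ℝ)) (t0 : Fin (i + j) → ℝ)
    (hα : ∀ l, IsIntPt (α (Pi.single l 1))) (hβ : ∀ l, IsIntPt (β (Pi.single l 1)))
    (A : Set (Fin i → ℝ)) (B : Set (Fin j → ℝ)) :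
    ∃ z : ℤ, (volume ((fun p : (Fin i → ℝ) × (Fin j → ℝ) => t0 + (α p.1 + β p.2)) '' (A ×ˢ B))).toReal
      = z * ((volume A).toReal * (volume B).toReal) := by
  let Me : (Fin (i + j) → ℝ) ≃ᵐ (Fin i → ℝ) × (Fin j → ℝ) :=
    (MeasurableEquiv.piCongrLeft (fun _ => ℝ) finSumFinEquiv).symm.trans
      (MeasurableEquiv.sumPiEquivProdPi fun _ => ℝ)
  have hMe : MeasurePreserving Me :=
    (volume_measurePreserving_piCongrLeft (fun _ => ℝ) finSumFinEquiv).symm.trans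
      (volume_measurePreserving_sumPiEquivProdPi fun _ => ℝ)
  have hMe1 : ∀ x l, (Me x).1 l = x (Fin.castAdd j l) := fun x l => rfl
  have hMe2 : ∀ x l, (Me x).2 l = x (Fin.natAdd i l) := fun x l => rfl
  let R1 : (Fin (i + j) → ℝ) →ₗ[ℝ] (Fin i → ℝ) := LinearMap.funLeft ℝ ℝ (Fin.castAdd j)
  let R2 : (Fin (i + j) → ℝ) →ₗ[ℝ] (Fin j → ℝ) := LinearMap.funLeft ℝ ℝ (Fin.natAdd i)
  have hR1 : ∀ x, R1 x = (Me x).1 := fun x => by ext l; rfl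
  have hR2 : ∀ x, R2 x = (Me x).2 := fun x => by ext l; rfl
  let T : (Fin (i + j) → ℝ) →ₗ[ℝ] (Fin (i + j) → ℝ) := α ∘ₗ R1 + β ∘ₗ R2
  obtain ⟨z, hz⟩ := det_int T (by
    intro l
    refine Fin.addCases (fun l => ?_) (fun l => ?_) l
    · have h1 : R1 (Pi.single (Fin.castAdd j l) 1) = Pi.single l 1 := by
        ext m; simp [R1, LinearMap.funLeft_apply, Pi.single_apply]
      have h2 : R2 (Pi.single (Fin.castAdd j l) 1) = 0 := by
        ext m; simp [R2, LinearMap.funLeft_apply, Pi.single_apply, Fin.ext_iff]; omega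
      simp only [T, LinearMap.add_apply, LinearMap.comp_apply, h1, h2, map_zero, add_zero]
      exact hα l
    · have h1 : R1 (Pi.single (Fin.natAdd i l) 1) = 0 := by
        ext m; simp [R1, LinearMap.funLeft_apply, Pi.single_apply, Fin.ext_iff]; omega
      have h2 : R2 (Pi.single (Fin.natAdd i l) 1) = Pi.single l 1 := by
        ext m; simp [R2, LinearMap.funLeft_apply, Pi.single_apply]
      simp only [T, LinearMap.add_apply, LinearMap.comp_apply, h1, h2, map_zero, zero_add]
      exact hβ l)
  refine ⟨z, ?_⟩
  have himg : (fun p : (Fin i → ℝ) × (Fin j → ℝ) => t0 + (α p.1 + β p.2)) '' (A ×ˢ B) =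
      (fun x => t0 + x) '' (T '' (Me ⁻¹' (A ×ˢ B))) := by
    rw [Set.image_image]
    have : A ×ˢ B = Me '' (Me ⁻¹' (A ×ˢ B)) := by
      rw [Set.image_preimage_eq _ Me.surjective]
    conv_lhs => rw [this]
    rw [Set.image_image]
    refine Set.image_congr fun x _ => ?_
    simp only [T, LinearMap.add_apply, LinearMap.comp_apply, hR1, hR2]
  rw [himg, Set.image_add_left, measure_preimage_add, Measure.addHaar_image_linearMap,
    hMe.measure_preimage_equiv, Measure.volume_eq_prod, Measure.prod_prod,
    ENNReal.toReal_mul, ENNReal.toReal_mul, ENNReal.toReal_ofReal (abs_nonneg _), hz]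

theorem normVol_chart {n : ℕ} (P : Set (Fin n → ℝ))
    (h : ∃ φ : (Fin n → ℝ) →ᵃ[ℝ] (Fin (polyDim P) → ℝ), IsLatticeChart P φ) :
    ∃ φ : (Fin n → ℝ) →ᵃ[ℝ] (Fin (polyDim P) → ℝ), IsLatticeChart P φ ∧
      normVol P = (polyDim P).factorial * (volume (φ '' P)).toReal := by
  refine ⟨h.choose, h.choose_spec, ?_⟩
  rw [normVol, dif_pos h]

theorem normVol_int {n : ℕ} (V : Finset (Fin n → ℝ)) (hne : V.Nonempty) (hV : ∀ v ∈ V, IsIntPt v)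
    (P : Set (Fin n → ℝ)) (hP : P = convexHull ℝ (V : Set (Fin n → ℝ))) :
    ∃ φ : (Fin n → ℝ) →ᵃ[ℝ] (Fin (polyDim P) → ℝ), IsLatticeChart P φ ∧
      normVol P = (polyDim P).factorial * (volume (φ '' P)).toReal ∧ ∃ m : ℤ, normVol P = m := by
  classical
  obtain ⟨φ, hφ, hvol⟩ := normVol_chart P (chart_exists V hne hV P hP)
  refine ⟨φ, hφ, hvol, ?_⟩
  rw [hvol]
  have h1 : φ '' P = convexHull ℝ ((V.image φ : Finset _) : Set (Fin (polyDim P) → ℝ)) := by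
    rw [Finset.coe_image, ← φ.image_convexHull, ← hP]
  rw [h1]
  apply poly_int _ (hne.image φ)
  intro v hv
  obtain ⟨w, hw, rfl⟩ := Finset.mem_image.1 hv
  refine (hφ.2 w ?_).1 (hV w hw)
  apply subset_affineSpan
  rw [hP]
  exact subset_convexHull _ _ hw

theorem cell_even {n d k : ℕ} (F G : Set (Fin n → ℝ)) (VF VG : Finset (Fin n → ℝ))
    (hVFne : VF.Nonempty) (hVGne : VG.Nonempty)
    (hVF : ∀ v ∈ VF, IsIntPt v) (hVG : ∀ v ∈ VG, IsIntPt v)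
    (hF : F = convexHull ℝ (VF : Set (Fin n → ℝ))) (hG : G = convexHull ℝ (VG : Set (Fin n → ℝ)))
    (A : (Fin n → ℝ) →ₗ[ℝ] (Fin d → ℝ))
    (hAF : ∀ x ∈ vectorSpan ℝ F, IsIntPt x → IsIntPt (A x))
    (hAG : ∀ x ∈ vectorSpan ℝ G, IsIntPt x → IsIntPt (A x))
    (hinj : ∀ a ∈ vectorSpan ℝ F, ∀ b ∈ vectorSpan ℝ G, A a + A b = 0 → a = 0 ∧ b = 0)
    (hd : 2 ^ k ≤ d)
    (hFe : 2 ^ k ≤ polyDim F → EvenVol F) (hGe : 2 ^ k ≤ polyDim G → EvenVol G) :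
    ∃ m : ℤ, (d.factorial : ℝ) * (volume ((A.coprod A) '' (F ×ˢ G))).toReal = 2 * m := by
  obtain ⟨φ, hφ, hFv, mF, hmF⟩ := normVol_int VF hVFne hVF F hF
  obtain ⟨χ, hχ, hGv, mG, hmG⟩ := normVol_int VG hVGne hVG G hG
  have hFne : F.Nonempty := by rw [hF]; exact (convexHull_nonempty_iff.2 hVFne)
  have hGne : G.Nonempty := by rw [hG]; exact (convexHull_nonempty_iff.2 hVGne)
  obtain ⟨ψ, hψ1, hψ2, hψ3, hψ4⟩ := chart_inv F hFne φ hφ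
  obtain ⟨ω, hω1, hω2, hω3, hω4⟩ := chart_inv G hGne χ hχ
  have hle : polyDim F + polyDim G ≤ d := by
    let Lm : (vectorSpan ℝ F × vectorSpan ℝ G) →ₗ[ℝ] (Fin d → ℝ) :=
      (A ∘ₗ (vectorSpan ℝ F).subtype).coprod (A ∘ₗ (vectorSpan ℝ G).subtype)
    have hLinj : Function.Injective Lm := by
      rw [← LinearMap.ker_eq_bot, LinearMap.ker_eq_bot']
      rintro ⟨a, b⟩ h
      obtain ⟨h1, h2⟩ := hinj a a.2 b b.2 (by simpa [Lm] using h)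
      exact Prod.ext (Subtype.ext h1) (Subtype.ext h2)
    have := LinearMap.finrank_le_finrank_of_injective hLinj
    rw [Module.finrank_prod] at this
    rw [Module.finrank_fin_fun] at this
    rw [polyDim, polyDim, direction_affineSpan, direction_affineSpan]
    exact this
  let α : (Fin (polyDim F) → ℝ) →ₗ[ℝ] (Fin d → ℝ) := A ∘ₗ ψ.linear
  let β : (Fin (polyDim G) → ℝ) →ₗ[ℝ] (Fin d → ℝ) := A ∘ₗ ω.linear
  have hψa : ∀ s, ψ s = ψ.linear s + ψ 0 := fun s => by
    have := ψ.map_vadd 0 s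
    simpa using this
  have hωa : ∀ s, ω s = ω.linear s + ω 0 := fun s => by
    have := ω.map_vadd 0 s
    simpa using this
  have hint0 : ∀ r : ℕ, IsIntPt (0 : Fin r → ℝ) := fun r i => ⟨0, by simp⟩
  have hintS : ∀ (r : ℕ) (l : Fin r), IsIntPt (Pi.single l 1 : Fin r → ℝ) := fun r l i => by
    by_cases h : i = l
    · subst h; exact ⟨1, by simp⟩
    · exact ⟨0, by simp [h]⟩
  have hα : ∀ l, IsIntPt (α (Pi.single l 1)) := by
    intro l
    have e : ψ.linear (Pi.single l 1) = ψ (Pi.single l 1) - ψ 0 := by rw [hψa (Pi.single l 1)]; simp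
    refine hAF _ ?_ ?_
    · rw [e, ← direction_affineSpan]
      exact AffineSubspace.vsub_mem_direction (hψ1 _) (hψ1 _)
    · rw [e]
      exact (hψ4 _ (hintS _ l)).sub' (hψ4 _ (hint0 _))
  have hβ : ∀ l, IsIntPt (β (Pi.single l 1)) := by
    intro l
    have e : ω.linear (Pi.single l 1) = ω (Pi.single l 1) - ω 0 := by rw [hωa (Pi.single l 1)]; simp
    refine hAG _ ?_ ?_
    · rw [e, ← direction_affineSpan]
      exact AffineSubspace.vsub_mem_direction (hω1 _) (hω1 _)
    · rw [e]
      exact (hω4 _ (hintS _ l)).sub' (hω4 _ (hint0 _))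
  let t0 := A (ψ 0) + A (ω 0)
  have himg : (A.coprod A) '' (F ×ˢ G) =
      (fun p : (Fin (polyDim F) → ℝ) × (Fin (polyDim G) → ℝ) => t0 + (α p.1 + β p.2)) ''
        ((φ '' F) ×ˢ (χ '' G)) := by
    rw [← Set.prodMap_image_prod, Set.image_image]
    refine Set.image_congr ?_
    rintro ⟨x, y⟩ ⟨hx, hy⟩
    have h1 := hψ3 x (subset_affineSpan ℝ F hx)
    have h2 := hω3 y (subset_affineSpan ℝ G hy)
    rw [hψa] at h1
    rw [hωa] at h2
    simp only [LinearMap.coprod_apply, Prod.map_apply, t0, α, β, LinearMap.comp_apply]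
    conv_lhs => rw [← h1, ← h2]
    simp only [map_add]
    abel
  rw [himg]
  clear_value t0
  rcases lt_or_eq_of_le hle with hlt | heq
  · refine ⟨0, ?_⟩
    have h0 : volume ((fun p : (Fin (polyDim F) → ℝ) × (Fin (polyDim G) → ℝ) => t0 + (α p.1 + β p.2)) ''
        ((φ '' F) ×ˢ (χ '' G))) = 0 := by
      have hsub : (fun p : (Fin (polyDim F) → ℝ) × (Fin (polyDim G) → ℝ) => t0 + (α p.1 + β p.2)) ''
        ((φ '' F) ×ˢ (χ '' G)) ⊆ (fun x => t0 + x) '' (LinearMap.range (α.coprod β) : Set (Fin d → ℝ)) := by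
        rintro _ ⟨p, -, rfl⟩
        exact ⟨α p.1 + β p.2, ⟨p, by simp⟩, rfl⟩
      refine measure_mono_null hsub ?_
      rw [Set.image_add_left, measure_preimage_add]
      refine Measure.addHaar_submodule _ _ ?_
      intro htop
      have h1 := LinearMap.finrank_range_le (α.coprod β)
      rw [htop, finrank_top] at h1
      simp at h1
      omega
    rw [h0]; simp
  · generalize hi : polyDim F = i at *
    generalize hj : polyDim G = j at *
    subst heq
    obtain ⟨z, hz⟩ := prod_vol α β t0 hα hβ (φ '' F) (χ '' G)
    rw [hz]
    have hch : (((i + j).choose i : ℕ) : ℝ) * (i.factorial * j.factorial) = ((i + j).factorial : ℕ) := by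
      have := Nat.add_choose_mul_factorial_mul_factorial i j
      rw [← this, Nat.choose_symm_add]; push_cast; ring
    have hform : ((i + j).factorial : ℝ) * (z * ((volume (φ '' F)).toReal * (volume (χ '' G)).toReal)) =
        ((i + j).choose i : ℕ) * (z * (normVol F * normVol G)) := by
      rw [hFv, hGv, ← hch]; ring
    rw [hform]
    by_cases h1 : 2 ^ k ≤ i
    · obtain ⟨m, hm⟩ := hFe h1
      exact ⟨((i + j).choose i : ℕ) * (z * (m * mG)), by rw [hm, hmG]; push_cast; ring⟩
    by_cases h2 : 2 ^ k ≤ j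
    · obtain ⟨m, hm⟩ := hGe h2
      exact ⟨((i + j).choose i : ℕ) * (z * (mF * m)), by rw [hm, hmF]; push_cast; ring⟩
    obtain ⟨q, hq⟩ := choose_even (not_le.1 h1) (not_le.1 h2) hd
    exact ⟨q * (z * (mF * mG)), by rw [hq, hmF, hmG]; push_cast; ring⟩

theorem latt_verts {n : ℕ} {P : Set (Fin n → ℝ)} (h : IsLatticePolytope P) :
    ∃ V : Finset (Fin n → ℝ), V.Nonempty ∧ (∀ v ∈ V, IsIntPt v) ∧ P = convexHull ℝ (V : Set (Fin n → ℝ)) := by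
  classical
  obtain ⟨V, hne, rfl⟩ := h
  refine ⟨V.image (fun v (i : Fin n) => ((v i : ℤ) : ℝ)), hne.image _, ?_, ?_⟩
  · intro v hv
    obtain ⟨w, _, rfl⟩ := Finset.mem_image.1 hv
    exact fun i => ⟨w i, rfl⟩
  · rw [Finset.coe_image]

def dotL {n : ℕ} (c : Fin n → ℝ) : (Fin n → ℝ) →ₗ[ℝ] ℝ where
  toFun x := dotR c x
  map_add' x y := by simp [dotR, mul_add, Finset.sum_add_distrib]
  map_smul' r x := by
    simp only [dotR, Pi.smul_apply, smul_eq_mul, RingHom.id_apply, Finset.mul_sum]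
    exact Finset.sum_congr rfl fun i _ => by ring

theorem exists_dot {n : ℕ} (f : (Fin n → ℝ) →ₗ[ℝ] ℝ) : ∃ c, ∀ x, f x = dotR c x := by
  refine ⟨fun i => f (Pi.single i 1), fun x => ?_⟩
  have : f = dotL (fun i => f (Pi.single i 1)) := by
    apply LinearMap.pi_ext'
    intro i
    apply LinearMap.ext_ring
    simp [dotL, dotR, Pi.single_apply]
  exact congrArg (fun g => g x) this

theorem face_verts {n : ℕ} {P : Set (Fin n → ℝ)} (V : Finset (Fin n → ℝ)) (hne : V.Nonempty)
    (hV : ∀ v ∈ V, IsIntPt v) (hP : P = convexHull ℝ (V : Set (Fin n → ℝ))) (c : Fin n → ℝ) :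
    ∃ W : Finset (Fin n → ℝ), W.Nonempty ∧ (∀ v ∈ W, IsIntPt v) ∧
      argminSet c P = convexHull ℝ (W : Set (Fin n → ℝ)) := by
  classical
  obtain ⟨h1, h2⟩ := aux_face V (V.filter fun s => ∀ w ∈ V, dotL c s ≤ dotL c w) (dotL c) hne
    (fun s => by simp)
  refine ⟨_, h1, fun v hv => hV v (Finset.mem_filter.1 hv).1, ?_⟩
  rw [h2, hP]; rfl

theorem lin_int {n r : ℕ} (R : Set (Fin n → ℝ)) (φ : (Fin n → ℝ) →ᵃ[ℝ] (Fin r → ℝ))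
    (hφ : IsLatticeChart R φ) (p : Fin n → ℝ) (hp : p ∈ R) (hpi : IsIntPt p)
    (x : Fin n → ℝ) (hx : x ∈ vectorSpan ℝ R) (hxi : IsIntPt x) : IsIntPt (φ.linear x) := by
  have hpa : p ∈ affineSpan ℝ R := subset_affineSpan ℝ R hp
  have hq : x +ᵥ p ∈ affineSpan ℝ R := by
    apply AffineSubspace.vadd_mem_of_mem_direction _ hpa
    rwa [direction_affineSpan]
  have h1 := (hφ.2 p hpa).1 hpi
  have h2 := (hφ.2 _ hq).1 (by simpa using IsIntPt.add' hxi hpi)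
  have h3 : φ.linear x = φ (x +ᵥ p) - φ p := by
    rw [φ.map_vadd]; simp
  rw [h3]
  exact IsIntPt.sub' h2 h1

theorem vs_left {n : ℕ} (P Q : Set (Fin n → ℝ)) (hQ : Q.Nonempty) :
    vectorSpan ℝ P ≤ vectorSpan ℝ (P + Q) := by
  obtain ⟨q, hq⟩ := hQ
  rw [vectorSpan, Submodule.span_le]
  rintro _ ⟨a, ha, b, hb, rfl⟩
  have := vsub_mem_vectorSpan ℝ (Set.add_mem_add ha hq) (Set.add_mem_add hb hq)
  simpa using this

theorem vs_prod {E F : Type*} [AddCommGroup E] [Module ℝ E] [AddCommGroup F] [Module ℝ F]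
    (P : Set E) (Q : Set F) (hP : P.Nonempty) (hQ : Q.Nonempty) (a : E) (b : F)
    (ha : a ∈ vectorSpan ℝ P) (hb : b ∈ vectorSpan ℝ Q) : (a, b) ∈ vectorSpan ℝ (P ×ˢ Q) := by
  obtain ⟨q, hq⟩ := hQ
  obtain ⟨p, hp⟩ := hP
  have h1 : vectorSpan ℝ P ≤ (vectorSpan ℝ (P ×ˢ Q)).comap (LinearMap.inl ℝ E F) := by
    rw [vectorSpan, Submodule.span_le]
    rintro _ ⟨a, ha, b, hb, rfl⟩
    have := vsub_mem_vectorSpan ℝ (s := P ×ˢ Q) (Set.mk_mem_prod ha hq) (Set.mk_mem_prod hb hq)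
    simpa using this
  have h2 : vectorSpan ℝ Q ≤ (vectorSpan ℝ (P ×ˢ Q)).comap (LinearMap.inr ℝ E F) := by
    rw [vectorSpan, Submodule.span_le]
    rintro _ ⟨a, ha, b, hb, rfl⟩
    have := vsub_mem_vectorSpan ℝ (s := P ×ˢ Q) (Set.mk_mem_prod hp ha) (Set.mk_mem_prod hp hb)
    simpa using this
  have h3 : (a, (0 : F)) ∈ vectorSpan ℝ (P ×ˢ Q) := h1 ha
  have h4 : ((0 : E), b) ∈ vectorSpan ℝ (P ×ˢ Q) := h2 hb
  have := add_mem h3 h4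
  simpa using this

theorem argmin_prod {n : ℕ} (P Q : Set (Fin n → ℝ)) (c1 c2 : Fin n → ℝ)
    (ℓ : (Fin n → ℝ) × (Fin n → ℝ) →ₗ[ℝ] ℝ) (hℓ : ∀ x y, ℓ (x, y) = dotR c1 x + dotR c2 y) :
    {x ∈ P ×ˢ Q | ∀ y ∈ P ×ˢ Q, ℓ x ≤ ℓ y} = argminSet c1 P ×ˢ argminSet c2 Q := by
  ext ⟨x, y⟩
  simp only [Set.mem_ofPred_eq, Set.mem_prod, argminSet, Prod.forall, hℓ]
  constructor
  · rintro ⟨⟨hx, hy⟩, h⟩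
    refine ⟨⟨hx, fun z hz => ?_⟩, ⟨hy, fun z hz => ?_⟩⟩
    · linarith [h z y ⟨hz, hy⟩]
    · linarith [h x z ⟨hx, hz⟩]
  · rintro ⟨⟨hx, h1⟩, ⟨hy, h2⟩⟩
    exact ⟨⟨hx, hy⟩, fun a b hab => add_le_add (h1 a hab.1) (h2 b hab.2)⟩

theorem img_sum {n r : ℕ} (φ : (Fin n → ℝ) →ᵃ[ℝ] (Fin r → ℝ)) (P Q : Set (Fin n → ℝ)) :
    φ '' (P + Q) = (fun x => φ 0 + x) '' ((φ.linear.coprod φ.linear) '' (P ×ˢ Q)) := by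
  have hφa : ∀ s, φ s = φ.linear s + φ 0 := fun s => by
    have := φ.map_vadd 0 s
    simpa using this
  rw [← Set.add_image_prod, Set.image_image, Set.image_image]
  refine Set.image_congr fun x _ => ?_
  rw [hφa (x.1 + x.2)]
  simp [add_comm]


/-- If `P, Q ∈ Q_k` and `dim (P + Q) ≥ 2^k`, then `Vol(P + Q)` is even. -/
theorem normVol_minkowski_sum_even {n : ℕ} (k : ℕ) (P Q : Set (Fin n → ℝ))
    (hP : InQclass k P) (hQ : InQclass k Q) (hdim : 2 ^ k ≤ polyDim (P + Q)) :
    EvenVol (P + Q) := by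
  classical
  obtain ⟨VP, hVPne, hVPi, hPe⟩ := latt_verts hP.1
  obtain ⟨VQ, hVQne, hVQi, hQe⟩ := latt_verts hQ.1
  obtain ⟨vp, hvp⟩ := hVPne
  obtain ⟨vq, hvq⟩ := hVQne
  have hvpP : vp ∈ P := hPe ▸ subset_convexHull ℝ _ hvp
  have hvqQ : vq ∈ Q := hQe ▸ subset_convexHull ℝ _ hvq
  by_cases h : ∃ φ : (Fin n → ℝ) →ᵃ[ℝ] (Fin (polyDim (P + Q)) → ℝ), IsLatticeChart (P + Q) φ
  swap
  · refine ⟨0, ?_⟩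
    rw [normVol, dif_neg h]; simp
  obtain ⟨φ, hφ, hvol⟩ := normVol_chart (P + Q) h
  have hconv : convexHull ℝ ((VP ×ˢ VQ : Finset _) : Set ((Fin n → ℝ) × (Fin n → ℝ))) = P ×ˢ Q := by
    rw [Finset.coe_product, convexHull_prod, hPe, hQe]
  obtain ⟨Φ, hΦ, hsum⟩ := aux_cells (VP ×ˢ VQ) ⟨(vp, vq), Finset.mk_mem_product hvp hvq⟩
    (φ.linear.coprod φ.linear)
  have himg : φ '' (P + Q) = (fun x => φ 0 + x) '' ((φ.linear.coprod φ.linear) '' (P ×ˢ Q)) := img_sum φ P Q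
  have hv2 : volume (φ '' (P + Q)) = volume ((φ.linear.coprod φ.linear) '' (P ×ˢ Q)) := by
    rw [himg, Set.image_add_left, measure_preimage_add]
  rw [hconv] at hsum
  have hcell : ∀ S ∈ Φ, ∃ m : ℤ, ((polyDim (P + Q)).factorial : ℝ) *
      (volume ((φ.linear.coprod φ.linear) '' convexHull ℝ (S : Set ((Fin n → ℝ) × (Fin n → ℝ))))).toReal = 2 * m := by
    intro S hS
    obtain ⟨hSV, hSne, hdisj, ℓ, hℓ⟩ := hΦ S hS
    obtain ⟨c1, hc1⟩ := exists_dot (ℓ ∘ₗ LinearMap.inl ℝ _ _)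
    obtain ⟨c2, hc2⟩ := exists_dot (ℓ ∘ₗ LinearMap.inr ℝ _ _)
    have hℓ' : ∀ x y, ℓ (x, y) = dotR c1 x + dotR c2 y := fun x y => by
      rw [← hc1, ← hc2]
      simp [← map_add]
    rw [hconv, argmin_prod P Q c1 c2 ℓ hℓ'] at hℓ
    obtain ⟨VF, hVFne, hVFi, hF⟩ := face_verts VP ⟨vp, hvp⟩ hVPi hPe c1
    obtain ⟨VG, hVGne, hVGi, hG⟩ := face_verts VQ ⟨vq, hvq⟩ hVQi hQe c2
    have hFne : (argminSet c1 P).Nonempty := by rw [hF]; simpa using hVFne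
    have hGne : (argminSet c2 Q).Nonempty := by rw [hG]; simpa using hVGne
    rw [hℓ]
    have hpi : IsIntPt (vp + vq) := IsIntPt.add' (hVPi _ hvp) (hVQi _ hvq)
    have hpm : vp + vq ∈ P + Q := Set.add_mem_add hvpP hvqQ
    refine cell_even (k := k) _ _ VF VG hVFne hVGne hVFi hVGi hF hG φ.linear ?_ ?_ ?_ hdim
      (hP.2 _ (Or.inr ⟨c1, rfl⟩)) (hQ.2 _ (Or.inr ⟨c2, rfl⟩))
    · intro x hx hxi
      refine lin_int _ φ hφ _ hpm hpi x ?_ hxi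
      exact vs_left P Q ⟨vq, hvqQ⟩ (vectorSpan_mono ℝ (fun z hz => hz.1) hx)
    · intro x hx hxi
      refine lin_int _ φ hφ _ hpm hpi x ?_ hxi
      rw [add_comm P Q]
      exact vs_left Q P ⟨vp, hvpP⟩ (vectorSpan_mono ℝ (fun z hz => hz.1) hx)
    · intro a ha b hb hab
      have h1 := vs_prod _ _ hFne hGne a b ha hb
      rw [← hℓ, ← direction_affineSpan, affineSpan_convexHull, direction_affineSpan] at h1
      have h2 : (a, b) ∈ LinearMap.ker (φ.linear.coprod φ.linear) := by
        simpa using hab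
      have h3 := Submodule.disjoint_def.1 hdisj _ h1 h2
      exact Prod.mk_eq_zero.1 h3
  choose! m hm using hcell
  refine ⟨∑ S ∈ Φ, m S, ?_⟩
  rw [hvol, hv2, hsum, ENNReal.toReal_sum, Finset.mul_sum, Finset.sum_congr rfl hm, Int.cast_sum,
    Finset.mul_sum]
  intro S _
  have hc : IsCompact ((φ.linear.coprod φ.linear) '' convexHull ℝ (S : Set ((Fin n → ℝ) × (Fin n → ℝ)))) :=
    (Set.Finite.isCompact_convexHull ℝ S.finite_toSet).image (LinearMap.continuous_of_finiteDimensional _)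
  exact hc.measure_lt_top.ne

end
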